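/- For every k ∈ \bar{ℕ}^ℓ, the map φ(k) : E → {0,1} is a character of E (it is nonzero, multiplicative, and vanishes at 0), and the associated filter A_{φ(k)} := {e ∈ E : φ(k)(e) = 1} is an ultrafilter, i.e. a maximal element among filters in E ordered by inclusion. -/

import Mathlib

open scoped BigOperators

noncomputable section

/-- The Hilbert space `H = ℓ²(ℕ^ℓ × ℤ)`. -/
abbrev H (ℓ : ℕ) : Type := lp (fun _ : (Fin ℓ → ℕ) × ℤ => ℂ) 2

/-- The standard basis vector `e_{(a,z)}` of `H`. -/
noncomputable def basisVec (ℓ : ℕ) (a : Fin ℓ → ℕ) (z : ℤ) : H ℓ :=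
  lp.single 2 (a, z) 1

/-- `IsBop ℓ B` says that for each `i : Fin (ℓ+1)`, `r : ℤ` and `m n : Fin ℓ → ℕ`,
`B i r m n` is the operator `B_{i+1}(r,m,n)` of the paper (paper index `i ∈ {1,…,ℓ+1}`
is `i-1 : Fin (ℓ+1)` here).  For `k : Fin ℓ` (paper index `k+1 ≤ ℓ`) :
`B k r m n e_{(a,z)} = e_{(a',z+Σ_{j≤k}(m_j−n_j))}` if `a_j = n_j` for `j < k` and
`a_k ≥ n_k` (where `a'_j = m_j` for `j < k`, `a'_k = a_k − n_k + m_k`, `a'_j = a_j`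
for `j > k`), and `= 0` otherwise; and
`B ℓ r m n e_{(a,z)} = e_{(m, z + r + Σ_j (m_j − n_j))}` if `a = n`, and `= 0` otherwise. -/
def IsBop (ℓ : ℕ)
    (B : Fin (ℓ + 1) → ℤ → (Fin ℓ → ℕ) → (Fin ℓ → ℕ) → (H ℓ →L[ℂ] H ℓ)) : Prop :=
  (∀ (k : Fin ℓ) (r : ℤ) (m n : Fin ℓ → ℕ) (a : Fin ℓ → ℕ) (z : ℤ),
      B k.castSucc r m n (basisVec ℓ a z) =
        if (∀ j : Fin ℓ, j < k → a j = n j) ∧ n k ≤ a k then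
          basisVec ℓ
            (fun j => if j < k then m j else if j = k then a k - n k + m k else a j)
            (z + ∑ j ∈ Finset.univ.filter (fun j : Fin ℓ => j ≤ k), ((m j : ℤ) - (n j : ℤ)))
        else 0) ∧
  (∀ (r : ℤ) (m n : Fin ℓ → ℕ) (a : Fin ℓ → ℕ) (z : ℤ),
      B (Fin.last ℓ) r m n (basisVec ℓ a z) =
        if a = n then basisVec ℓ m (z + r + ∑ j, ((m j : ℤ) - (n j : ℤ))) else 0)

/-- The set of projections `E = {0} ∪ {p_i(m)}`, where `p_i(m) = B_i(0,m,m)`. -/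
def Eset (ℓ : ℕ)
    (B : Fin (ℓ + 1) → ℤ → (Fin ℓ → ℕ) → (Fin ℓ → ℕ) → (H ℓ →L[ℂ] H ℓ)) :
    Set (H ℓ →L[ℂ] H ℓ) :=
  {0} ∪ {x | ∃ (i : Fin (ℓ + 1)) (m : Fin ℓ → ℕ), x = B i 0 m m}

/-- A filter in `E`: a nonempty subset `A ⊆ E` with `0 ∉ A`, closed under (operator)
multiplication, and upward closed in `E` for the usual (Loewner) order on operators. -/
def IsFilterIn (ℓ : ℕ)
    (B : Fin (ℓ + 1) → ℤ → (Fin ℓ → ℕ) → (Fin ℓ → ℕ) → (H ℓ →L[ℂ] H ℓ))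
    (A : Set (H ℓ →L[ℂ] H ℓ)) : Prop :=
  A.Nonempty ∧ A ⊆ Eset ℓ B ∧ (0 : H ℓ →L[ℂ] H ℓ) ∉ A ∧
    (∀ e ∈ A, ∀ f ∈ A, e * f ∈ A) ∧
    (∀ e ∈ A, ∀ f ∈ Eset ℓ B, e ≤ f → f ∈ A)

/-- An ultrafilter in `E`: a filter maximal under inclusion. -/
def IsUltrafilterIn (ℓ : ℕ)
    (B : Fin (ℓ + 1) → ℤ → (Fin ℓ → ℕ) → (Fin ℓ → ℕ) → (H ℓ →L[ℂ] H ℓ))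
    (A : Set (H ℓ →L[ℂ] H ℓ)) : Prop :=
  IsFilterIn ℓ B A ∧ ∀ A' : Set (H ℓ →L[ℂ] H ℓ), IsFilterIn ℓ B A' → A ⊆ A' → A' = A

/-- A character of `E`: a nonzero multiplicative map `E → {0,1}` (valued in `Bool`,
with `&&` as multiplication) vanishing at `0`. -/
def IsCharacter (ℓ : ℕ)
    (B : Fin (ℓ + 1) → ℤ → (Fin ℓ → ℕ) → (Fin ℓ → ℕ) → (H ℓ →L[ℂ] H ℓ))
    (x : {e : H ℓ →L[ℂ] H ℓ // e ∈ Eset ℓ B} → Bool) : Prop :=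
  (∃ e, x e = true) ∧
    (∀ (e f : {e : H ℓ →L[ℂ] H ℓ // e ∈ Eset ℓ B}) (h : e.val * f.val ∈ Eset ℓ B),
      x ⟨e.val * f.val, h⟩ = (x e && x f)) ∧
    (∀ h : (0 : H ℓ →L[ℂ] H ℓ) ∈ Eset ℓ B, x ⟨0, h⟩ = false)

/-- `LeastInf ℓ k r` says that `r` is the least nonnegative integer such that
`k_{r+1} = ∞` (paper indexing, with the convention `k_{ℓ+1} = ∞`).  In the 0-indexed
formulation: `r ≤ ℓ`, `k r = ∞` if `r < ℓ`, and `k j ≠ ∞` for all `j < r`. -/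
def LeastInf (ℓ : ℕ) (k : Fin ℓ → ℕ∞) (r : ℕ) : Prop :=
  r ≤ ℓ ∧ (∀ h : r < ℓ, k ⟨r, h⟩ = ⊤) ∧ ∀ j : Fin ℓ, (j : ℕ) < r → k j ≠ ⊤

/-- The support of the character `φ(k)`, `k ∈ ℕ̄^ℓ`: it contains `p_i(m)` (paper index
`i ≤ ℓ`) iff `π_{i−1}(m) = π_{i−1}(k)` and `m_i ≤ k_i`, and `p_{ℓ+1}(m)` iff `m = k`. -/
def phiSupp (ℓ : ℕ)
    (B : Fin (ℓ + 1) → ℤ → (Fin ℓ → ℕ) → (Fin ℓ → ℕ) → (H ℓ →L[ℂ] H ℓ))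
    (k : Fin ℓ → ℕ∞) : Set (H ℓ →L[ℂ] H ℓ) :=
  {x | (∃ (i : Fin ℓ) (m : Fin ℓ → ℕ), x = B i.castSucc 0 m m ∧
          (∀ j : Fin ℓ, j < i → (m j : ℕ∞) = k j) ∧ (m i : ℕ∞) ≤ k i) ∨
       (∃ m : Fin ℓ → ℕ, x = B (Fin.last ℓ) 0 m m ∧ ∀ j : Fin ℓ, (m j : ℕ∞) = k j)}

open Classical in
/-- The character `φ(k) : E → {0,1}` associated to `k ∈ ℕ̄^ℓ`. -/
noncomputable def phi (ℓ : ℕ)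
    (B : Fin (ℓ + 1) → ℤ → (Fin ℓ → ℕ) → (Fin ℓ → ℕ) → (H ℓ →L[ℂ] H ℓ))
    (k : Fin ℓ → ℕ∞) : {e : H ℓ →L[ℂ] H ℓ // e ∈ Eset ℓ B} → Bool :=
  fun e => decide (e.val ∈ phiSupp ℓ B k)

open Filter in
/-- A natural number `m` compares with a large truncation of `x : ℕ∞` as it does with `x`. -/
lemma eventually_compare_truncation (m : ℕ) (x : ℕ∞) :
    ∀ᶠ N : ℕ in atTop, (((min x N).toNat = m ↔ (m : ℕ∞) = x) ∧
      (m ≤ (min x N).toNat ↔ (m : ℕ∞) ≤ x)) := by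
  cases x with
  | top =>
    filter_upwards [eventually_gt_atTop m] with N hN
    simp
    omega
  | coe x =>
    filter_upwards [eventually_gt_atTop (max m x)] with N hN
    rw [min_eq_left (by exact_mod_cast (show x ≤ N by omega)), ENat.toNat_natCast]
    norm_cast
    omega

/-- The set of multi-indices `a` such that the projection `p_{i+1}(m)` fixes `e_{(a,z)}`. -/
def projSet {ℓ : ℕ} (i : Fin (ℓ + 1)) (m : Fin ℓ → ℕ) : Set (Fin ℓ → ℕ) :=
  {a | (∀ j : Fin ℓ, j.castSucc < i → a j = m j) ∧ ∀ j : Fin ℓ, j.castSucc = i → m j ≤ a j}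

/-- Two of the sets `projSet i m` that meet are comparable. -/
lemma projSet_subset_or_subset {ℓ : ℕ} {i i' : Fin (ℓ + 1)} {m m' a : Fin ℓ → ℕ}
    (ha : a ∈ projSet i m) (ha' : a ∈ projSet i' m') :
    projSet i m ⊆ projSet i' m' ∨ projSet i' m' ⊆ projSet i m := by
  have nested : ∀ {i i' : Fin (ℓ + 1)} {m m' : Fin ℓ → ℕ}, a ∈ projSet i m →
      a ∈ projSet i' m' → i < i' → projSet i' m' ⊆ projSet i m := by
    rintro i i' m m' ⟨h1, h2⟩ ⟨h1', -⟩ hlt b ⟨hb, -⟩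
    refine ⟨fun j hj => ?_, fun j hj => ?_⟩
    · rw [hb j (hj.trans hlt), ← h1' j (hj.trans hlt), h1 j hj]
    · rw [hb j (hj ▸ hlt), ← h1' j (hj ▸ hlt)]
      exact h2 j hj
  rcases lt_trichotomy i i' with h | rfl | h
  · exact Or.inr (nested ha ha' h)
  · have agree : ∀ j : Fin ℓ, j.castSucc < i → m j = m' j := fun j hj =>
      (ha.1 j hj).symm.trans (ha'.1 j hj)
    by_cases hle : ∀ j : Fin ℓ, j.castSucc = i → m' j ≤ m j
    · exact Or.inl fun b hb => ⟨fun j hj => (hb.1 j hj).trans (agree j hj),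
        fun j hj => (hle j hj).trans (hb.2 j hj)⟩
    · push Not at hle
      obtain ⟨j₀, rfl, hlt⟩ := hle
      refine Or.inr fun b hb => ⟨fun j hj => (hb.1 j hj).trans (agree j hj).symm,
        fun j hj => ?_⟩
      obtain rfl := Fin.castSucc_injective _ hj
      exact hlt.le.trans (hb.2 j rfl)
  · exact Or.inl (nested ha' ha h)

lemma basisVec_ne_zero (ℓ : ℕ) (a : Fin ℓ → ℕ) (z : ℤ) : basisVec ℓ a z ≠ 0 := by
  intro h
  have := congrArg (fun f : H ℓ => f (a, z)) h
  simp [basisVec] at this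

/-- Bounded operators on `H ℓ` agreeing on the standard basis are equal. -/
lemma ext_basisVec {ℓ : ℕ} {S T : H ℓ →L[ℂ] H ℓ}
    (h : ∀ a z, S (basisVec ℓ a z) = T (basisVec ℓ a z)) : S = T := by
  refine lp.ext_continuousLinearMap (by simp) fun i => ?_
  ext1
  exact h i.1 i.2

section

variable {ℓ : ℕ} {B : Fin (ℓ + 1) → ℤ → (Fin ℓ → ℕ) → (Fin ℓ → ℕ) → (H ℓ →L[ℂ] H ℓ)}

open Classical in
lemma IsBop.proj_apply (hB : IsBop ℓ B) (i : Fin (ℓ + 1)) (m a : Fin ℓ → ℕ) (z : ℤ) :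
    B i 0 m m (basisVec ℓ a z) = if a ∈ projSet i m then basisVec ℓ a z else 0 := by
  induction i using Fin.lastCases with
  | last =>
    rw [hB.2]
    have : a ∈ projSet (Fin.last ℓ) m ↔ a = m := by
      simp [projSet, Fin.castSucc_lt_last, funext_iff]
    rw [if_congr this rfl rfl]
    by_cases h : a = m <;> simp [h]
  | cast i =>
    rw [hB.1]
    have : a ∈ projSet i.castSucc m ↔ (∀ j : Fin ℓ, j < i → a j = m j) ∧ m i ≤ a i := by
      simp [projSet]
    by_cases h : (∀ j : Fin ℓ, j < i → a j = m j) ∧ m i ≤ a i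
    · rw [if_pos h, if_pos (this.2 h)]
      congr 1
      · funext j
        split_ifs with h1 h2
        · exact (h.1 j h1).symm
        · subst h2
          exact Nat.sub_add_cancel h.2
        · rfl
      · simp
    · rw [if_neg h, if_neg (mt this.1 h)]

lemma IsBop.proj_apply_eq_self_iff (hB : IsBop ℓ B) (i : Fin (ℓ + 1)) (m a : Fin ℓ → ℕ) (z : ℤ) :
    B i 0 m m (basisVec ℓ a z) = basisVec ℓ a z ↔ a ∈ projSet i m := by
  rw [hB.proj_apply]
  split_ifs with h
  · simp [h]
  · simp [h, (basisVec_ne_zero ℓ a z).symm]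

lemma IsBop.apply_eq_self_or_eq_zero (hB : IsBop ℓ B) {e : H ℓ →L[ℂ] H ℓ} (he : e ∈ Eset ℓ B)
    (a : Fin ℓ → ℕ) (z : ℤ) :
    e (basisVec ℓ a z) = basisVec ℓ a z ∨ e (basisVec ℓ a z) = 0 := by
  rcases he with rfl | ⟨i, m, rfl⟩
  · exact Or.inr rfl
  · rw [hB.proj_apply]
    split_ifs <;> simp

lemma IsBop.mul_apply_eq_self_iff (hB : IsBop ℓ B) {e f : H ℓ →L[ℂ] H ℓ} (hf : f ∈ Eset ℓ B)
    (a : Fin ℓ → ℕ) (z : ℤ) :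
    (e * f) (basisVec ℓ a z) = basisVec ℓ a z ↔
      e (basisVec ℓ a z) = basisVec ℓ a z ∧ f (basisVec ℓ a z) = basisVec ℓ a z := by
  rw [mul_apply_eq_comp]
  rcases hB.apply_eq_self_or_eq_zero hf a z with h | h
  · simp [h]
  · simp [h, (basisVec_ne_zero ℓ a z).symm]

/-- Two projections in `E` with a common fixed basis vector have product in `E`. -/
lemma IsBop.mul_mem_Eset (hB : IsBop ℓ B) {e f : H ℓ →L[ℂ] H ℓ} (he : e ∈ Eset ℓ B)
    (hf : f ∈ Eset ℓ B) {a : Fin ℓ → ℕ} {z : ℤ} (hea : e (basisVec ℓ a z) = basisVec ℓ a z)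
    (hfa : f (basisVec ℓ a z) = basisVec ℓ a z) : e * f ∈ Eset ℓ B := by
  rcases he with rfl | ⟨i, m, rfl⟩
  · exact absurd hea.symm (basisVec_ne_zero ℓ a z)
  rcases hf with rfl | ⟨i', m', rfl⟩
  · exact absurd hfa.symm (basisVec_ne_zero ℓ a z)
  rw [hB.proj_apply_eq_self_iff] at hea hfa
  rcases projSet_subset_or_subset hea hfa with h | h
  · refine Or.inr ⟨i, m, ext_basisVec fun b w => ?_⟩
    rw [mul_apply_eq_comp, hB.proj_apply i', hB.proj_apply i]
    by_cases hb : b ∈ projSet i m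
    · simp [h hb, hb, hB.proj_apply]
    · by_cases hb' : b ∈ projSet i' m' <;> simp [hb, hb', hB.proj_apply]
  · refine Or.inr ⟨i', m', ext_basisVec fun b w => ?_⟩
    rw [mul_apply_eq_comp, hB.proj_apply i']
    by_cases hb : b ∈ projSet i' m'
    · simp [h hb, hb, hB.proj_apply]
    · simp [hb]

lemma IsBop.apply_eq_self_of_le (hB : IsBop ℓ B) {e f : H ℓ →L[ℂ] H ℓ} (hf : f ∈ Eset ℓ B)
    (hef : e ≤ f) {a : Fin ℓ → ℕ} {z : ℤ} (he : e (basisVec ℓ a z) = basisVec ℓ a z) :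
    f (basisVec ℓ a z) = basisVec ℓ a z := by
  refine (hB.apply_eq_self_or_eq_zero hf a z).resolve_right fun h => ?_
  have hpos := ContinuousLinearMap.IsPositive.re_inner_nonneg_left
    ((ContinuousLinearMap.le_def e f).1 hef) (basisVec ℓ a z)
  rw [sub_apply, h, he, zero_sub, inner_neg_left, map_neg,
    inner_self_eq_norm_sq] at hpos
  have := norm_pos_iff.2 (basisVec_ne_zero ℓ a z)
  nlinarith

variable (B) in
lemma mem_phiSupp_iff_exists (k : Fin ℓ → ℕ∞) (x : H ℓ →L[ℂ] H ℓ) :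
    x ∈ phiSupp ℓ B k ↔ ∃ (i : Fin (ℓ + 1)) (m : Fin ℓ → ℕ), x = B i 0 m m ∧
      (∀ j : Fin ℓ, j.castSucc < i → (m j : ℕ∞) = k j) ∧
      ∀ j : Fin ℓ, j.castSucc = i → (m j : ℕ∞) ≤ k j := by
  simp [phiSupp, Fin.exists_fin_succ', Fin.castSucc_lt_last]

open Filter

/-- The truncation `j ↦ min (k j) N` of `k`. -/
def truncation (k : Fin ℓ → ℕ∞) (N : ℕ) : Fin ℓ → ℕ := fun j => (min (k j) N).toNat

lemma eventually_truncation_mem_projSet_iff (k : Fin ℓ → ℕ∞) (i : Fin (ℓ + 1)) (m : Fin ℓ → ℕ) :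
    ∀ᶠ N in atTop, (truncation k N ∈ projSet i m ↔
      (∀ j : Fin ℓ, j.castSucc < i → (m j : ℕ∞) = k j) ∧
      ∀ j : Fin ℓ, j.castSucc = i → (m j : ℕ∞) ≤ k j) := by
  filter_upwards [eventually_all.2 fun j => eventually_compare_truncation (m j) (k j)] with N hN
  simp only [projSet, truncation, Set.mem_ofPred_eq, hN]

/-- The support of `φ(k)` consists of the projections that fix the basis vectors at all large
truncations of `k`. -/
lemma IsBop.mem_phiSupp_iff (hB : IsBop ℓ B) (k : Fin ℓ → ℕ∞) {e : H ℓ →L[ℂ] H ℓ}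
    (he : e ∈ Eset ℓ B) :
    e ∈ phiSupp ℓ B k ↔
      ∀ᶠ N in atTop, e (basisVec ℓ (truncation k N) 0) = basisVec ℓ (truncation k N) 0 := by
  rw [mem_phiSupp_iff_exists]
  constructor
  · rintro ⟨i, m, rfl, h⟩
    filter_upwards [eventually_truncation_mem_projSet_iff k i m] with N hN
    rw [hB.proj_apply_eq_self_iff, hN]
    exact h
  · intro h
    rcases he with rfl | ⟨i, m, rfl⟩
    · obtain ⟨N, hN⟩ := h.exists
      exact absurd hN.symm (basisVec_ne_zero ℓ _ _)
    · obtain ⟨N, hN, hN'⟩ := (h.and (eventually_truncation_mem_projSet_iff k i m)).exists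
      rw [hB.proj_apply_eq_self_iff, hN'] at hN
      exact ⟨i, m, rfl, hN⟩

lemma IsBop.zero_notMem_phiSupp (hB : IsBop ℓ B) (k : Fin ℓ → ℕ∞) : 0 ∉ phiSupp ℓ B k := by
  rw [hB.mem_phiSupp_iff k (Or.inl rfl)]
  intro h
  obtain ⟨N, hN⟩ := h.exists
  exact basisVec_ne_zero ℓ _ _ hN.symm

lemma IsBop.mul_mem_phiSupp_iff (hB : IsBop ℓ B) (k : Fin ℓ → ℕ∞) {e f : H ℓ →L[ℂ] H ℓ}
    (he : e ∈ Eset ℓ B) (hf : f ∈ Eset ℓ B) (hef : e * f ∈ Eset ℓ B) :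
    e * f ∈ phiSupp ℓ B k ↔ e ∈ phiSupp ℓ B k ∧ f ∈ phiSupp ℓ B k := by
  rw [hB.mem_phiSupp_iff k he, hB.mem_phiSupp_iff k hf, hB.mem_phiSupp_iff k hef, ← eventually_and]
  simp only [hB.mul_apply_eq_self_iff hf]

variable (B) in
lemma exists_mem_Eset_inter_phiSupp (hℓ : 1 ≤ ℓ) (k : Fin ℓ → ℕ∞) :
    (Eset ℓ B ∩ phiSupp ℓ B k).Nonempty :=
  ⟨_, Or.inr ⟨Fin.castSucc ⟨0, hℓ⟩, 0, rfl⟩,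
    Or.inl ⟨⟨0, hℓ⟩, 0, rfl, fun j hj => absurd hj (by simp [Fin.lt_def]), by simp⟩⟩

lemma IsBop.isCharacter_phi (hB : IsBop ℓ B) (hℓ : 1 ≤ ℓ) (k : Fin ℓ → ℕ∞) :
    IsCharacter ℓ B (phi ℓ B k) := by
  refine ⟨?_, fun e f h => ?_, fun h => ?_⟩
  · obtain ⟨e, he, hk⟩ := exists_mem_Eset_inter_phiSupp B hℓ k
    exact ⟨⟨e, he⟩, by simpa [phi] using hk⟩
  · rw [Bool.eq_iff_iff]
    simpa [phi] using hB.mul_mem_phiSupp_iff k e.2 f.2 h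
  · simpa [phi] using hB.zero_notMem_phiSupp k

lemma IsBop.isFilterIn_phiSupp (hB : IsBop ℓ B) (hℓ : 1 ≤ ℓ) (k : Fin ℓ → ℕ∞) :
    IsFilterIn ℓ B (Eset ℓ B ∩ phiSupp ℓ B k) := by
  refine ⟨exists_mem_Eset_inter_phiSupp B hℓ k, Set.inter_subset_left,
    fun h => hB.zero_notMem_phiSupp k h.2, ?_, ?_⟩
  · rintro e ⟨he, hek⟩ f ⟨hf, hfk⟩
    obtain ⟨N, hNe, hNf⟩ :=
      (((hB.mem_phiSupp_iff k he).1 hek).and ((hB.mem_phiSupp_iff k hf).1 hfk)).exists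
    have hef := hB.mul_mem_Eset he hf hNe hNf
    exact ⟨hef, (hB.mul_mem_phiSupp_iff k he hf hef).2 ⟨hek, hfk⟩⟩
  · rintro e ⟨he, hek⟩ f hf hle
    refine ⟨hf, (hB.mem_phiSupp_iff k hf).2 ?_⟩
    filter_upwards [(hB.mem_phiSupp_iff k he).1 hek] with N hN
    exact hB.apply_eq_self_of_le hf hle hN

/-- A filter containing the support of `φ(k)` is contained in it. -/
lemma IsBop.subset_phiSupp_of_isFilterIn (hB : IsBop ℓ B) (k : Fin ℓ → ℕ∞)
    {A : Set (H ℓ →L[ℂ] H ℓ)} (hA : IsFilterIn ℓ B A) (hk : Eset ℓ B ∩ phiSupp ℓ B k ⊆ A) :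
    A ⊆ phiSupp ℓ B k := by
  obtain ⟨-, hAE, h0, hmul, -⟩ := hA
  intro e he
  rcases hAE he with rfl | ⟨i, m, rfl⟩
  · exact absurd he h0
  obtain ⟨r, hr, hrmin⟩ : ∃ r : Fin (ℓ + 1), (∀ j : Fin ℓ, j.castSucc = r → k j = ⊤) ∧
      ∀ j : Fin ℓ, j.castSucc < r → k j ≠ ⊤ := by
    obtain ⟨r, hr, hmin⟩ := wellFounded_lt.has_min
      {r : Fin (ℓ + 1) | ∀ j : Fin ℓ, j.castSucc = r → k j = ⊤}
      ⟨Fin.last ℓ, fun j hj => absurd hj (Fin.castSucc_lt_last j).ne⟩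
    refine ⟨r, hr, fun j hj htop => hmin j.castSucc (fun j' hj' => ?_) hj⟩
    rwa [Fin.castSucc_injective _ hj']
  have meet : ∀ n : ℕ, ∃ a ∈ projSet i m, (∀ j : Fin ℓ, j.castSucc < r → (a j : ℕ∞) = k j) ∧
      ∀ j : Fin ℓ, j.castSucc = r → n ≤ a j := by
    intro n
    let m' : Fin ℓ → ℕ := fun j => if j.castSucc < r then (k j).toNat else n
    have hm' : ∀ j : Fin ℓ, j.castSucc < r → (m' j : ℕ∞) = k j := fun j hj => by
      simp [m', hj, ENat.natCast_toNat (hrmin j hj)]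
    have hmem : B r 0 m' m' ∈ A := hk ⟨Or.inr ⟨r, m', rfl⟩,
      (mem_phiSupp_iff_exists B k _).2 ⟨r, m', rfl, hm', fun j hj => by simp [hr j hj]⟩⟩
    have hne : B i 0 m m * B r 0 m' m' ≠ 0 := fun h => h0 (h ▸ hmul _ he _ hmem)
    obtain ⟨a, ha, ha'⟩ : ∃ a, a ∈ projSet i m ∧ a ∈ projSet r m' := by
      by_contra! hdisj
      refine hne (ext_basisVec fun a z => ?_)
      rw [mul_apply_eq_comp, hB.proj_apply r]
      by_cases ha : a ∈ projSet r m'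
      · have ha' : a ∉ projSet i m := fun h => hdisj a h ha
        simp [ha, ha', hB.proj_apply]
      · simp [ha]
    refine ⟨a, ha, fun j hj => by rw [ha'.1 j hj, hm' j hj], fun j hj => ?_⟩
    simpa [m', hj] using ha'.2 j hj
  have hir : i ≤ r := by
    by_contra! hlt
    obtain ⟨j, rfl⟩ := Fin.exists_castSucc_eq.2 (hlt.trans_le (Fin.le_last i)).ne
    obtain ⟨a, ha, -, hge⟩ := meet (m j + 1)
    have := hge j rfl
    have := ha.1 j hlt
    omega
  obtain ⟨a, ha, hak, -⟩ := meet 0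
  refine (mem_phiSupp_iff_exists B k _).2 ⟨i, m, rfl, fun j hj => ?_, fun j hj => ?_⟩
  · rw [← ha.1 j hj, hak j (hj.trans_le hir)]
  · rcases hir.lt_or_eq with h | h
    · rw [← hak j (hj ▸ h)]
      exact_mod_cast ha.2 j hj
    · simp [hr j (hj.trans h)]

end

/-- For every `k ∈ ℕ̄^ℓ`, `φ(k)` is a character of `E`, and its associated filter
`A_{φ(k)} = {e ∈ E : φ(k)(e) = 1} = E ∩ supp φ(k)` is an ultrafilter. -/
theorem phi_is_character_ultrafilter (ℓ : ℕ) (hℓ : 1 ≤ ℓ)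
    (B : Fin (ℓ + 1) → ℤ → (Fin ℓ → ℕ) → (Fin ℓ → ℕ) → (H ℓ →L[ℂ] H ℓ))
    (hB : IsBop ℓ B) (k : Fin ℓ → ℕ∞) :
    IsCharacter ℓ B (phi ℓ B k) ∧
    IsUltrafilterIn ℓ B (Eset ℓ B ∩ phiSupp ℓ B k) := by
  refine ⟨hB.isCharacter_phi hℓ k, hB.isFilterIn_phiSupp hℓ k, fun A hA hk => ?_⟩
  exact (Set.subset_inter hA.2.1 (hB.subset_phiSupp_of_isFilterIn k hA hk)).antisymm hk
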